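/- For every positive integer n, Margenstern's Turing machine M4 never halts when started from the initial configuration ωb (A 1) 1^{n−1} bω: the computation never reaches an undefined transition. -/

import Mathlib

namespace Collatz

/-- The 3x+1 function. -/
def T (x : ℕ) : ℕ := if x % 2 = 0 then x / 2 else (3 * x + 1) / 2

/-- The 3x+1 conjecture: iterating `T` from any positive integer
eventually reaches the loop `2 ↦ 1 ↦ 2`. -/
def CollatzConjecture : Prop :=
  ∀ x : ℕ, 0 < x → ∃ k : ℕ, T^[k] x = 2 ∧ T^[k + 1] x = 1

inductive St | A | B | C
  deriving DecidableEq

inductive Sym | sb | s1 | sx | sa | sz | sr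
  deriving DecidableEq

open St Sym

/-- Transition table of Margenstern's Turing machine `M4`
(`true` = move right, `false` = move left); `delta A sr` is undefined. -/
def delta : St → Sym → Option (Sym × Bool × St)
  | A, sb => some (sb, true, A)
  | A, s1 => some (sx, true, B)
  | A, sx => some (s1, false, A)
  | A, sa => some (s1, false, A)
  | A, sz => some (sr, true, B)
  | A, sr => none
  | B, sb => some (s1, false, B)
  | B, s1 => some (sa, true, C)
  | B, sx => some (s1, false, B)
  | B, sa => some (s1, false, A)
  | B, sz => some (sx, true, B)
  | B, sr => some (sb, true, A)
  | C, sb => some (sz, false, C)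
  | C, s1 => some (sx, true, C)
  | C, sx => some (s1, false, C)
  | C, sa => some (sa, true, A)
  | C, sz => some (sr, true, C)
  | C, sr => some (sz, false, C)

structure Cfg where
  state : St
  head : ℤ
  tape : ℤ → Sym

/-- One step of the machine; `none` when the transition is undefined
(in particular in the halting state, which has no transitions).
In `delta`, the `Bool` component is the direction: `true` = right, `false` = left. -/
def step (c : Cfg) : Option Cfg :=
  (delta c.state (c.tape c.head)).map fun t =>
    ⟨t.2.2, c.head + (if t.2.1 then 1 else -1), Function.update c.tape c.head t.1⟩

/-- `steps n c` is the configuration after `n` steps from `c`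
(`none` if the machine has halted meanwhile). -/
def steps : ℕ → Cfg → Option Cfg
  | 0, c => some c
  | n + 1, c => (step c).bind (steps n)

/-- The tape holding the word `w` at positions `0, …, w.length - 1`,
and the blank symbol everywhere else. -/
def tapeOf (w : List Sym) : ℤ → Sym :=
  fun i => if 0 ≤ i then w.getD i.toNat sb else sb

/-- `c` is the configuration `ωb u (q s) v bω`, where `w = u ++ s :: v` and
`pos = u.length` (i.e. the tape holds exactly the word `w` surrounded by blanks,
the machine is in state `q`, and the head scans the symbol of `w` at index `pos`). -/
def IsConfig (c : Cfg) (q : St) (w : List Sym) (pos : ℕ) : Prop :=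
  c.state = q ∧ ∃ d : ℤ, c.head = d + pos ∧ c.tape = fun i => tapeOf w (i - d)

/-- The machine eventually reaches the configuration `ωb u (q s) v bω`. -/
def Reaches (c : Cfg) (q : St) (w : List Sym) (pos : ℕ) : Prop :=
  ∃ t : ℕ, ∃ c' : Cfg, steps t c = some c' ∧ IsConfig c' q w pos

/-- The machine halts when started from configuration `c`. -/
def Halts (c : Cfg) : Prop := ∃ n : ℕ, steps n c = none

/-- Initial configuration: word `w` on the tape, head on its leftmost symbol, state `A`. -/
def initCfg (w : List Sym) : Cfg := ⟨St.A, 0, tapeOf w⟩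

/-- Invariant on configurations: state, head position, tape. -/
inductive Inv : St → ℤ → (ℤ → Sym) → Prop
  | aLeft (h e : ℤ) (t : ℤ → Sym) (he : h + 1 < e)
      (low : ∀ i ≤ h, t i = sb ∨ t i = sx ∨ t i = sa)
      (one : ∀ i, h < i → i < e → t i = s1)
      (bl : ∀ i, e ≤ i → t i = sb) : Inv A h t
  | aRight (h m e : ℤ) (t : ℤ → Sym) (hm : h ≤ m) (me : m ≤ e) (he : h < e)
      (low : ∀ i < h, t i = sb ∨ t i = sx ∨ t i = sa)
      (one : ∀ i, h ≤ i → i < m → t i = s1)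
      (zz : ∀ i, m ≤ i → i < e → t i = sz)
      (bl : ∀ i, e ≤ i → t i = sb) : Inv A h t
  | bRight (h m e : ℤ) (t : ℤ → Sym) (hm : h ≤ m) (me : m ≤ e)
      (low : ∀ i < h, t i = sb ∨ t i = sx ∨ t i = sa)
      (one : ∀ i, h ≤ i → i < m → t i = s1)
      (zz : ∀ i, m ≤ i → i < e → t i = sz)
      (bl : ∀ i, e ≤ i → t i = sb) : Inv B h t
  | bRightR (p h e : ℤ) (t : ℤ → Sym) (ph : p < h) (he : h ≤ e)
      (low : ∀ i < p, t i = sb ∨ t i = sx ∨ t i = sa)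
      (hp : t p = sr)
      (xx : ∀ i, p < i → i < h → t i = sx)
      (zz : ∀ i, h ≤ i → i < e → t i = sz)
      (bl : ∀ i, e ≤ i → t i = sb) : Inv B h t
  | bLeft (h e : ℤ) (t : ℤ → Sym) (he : h + 1 < e)
      (low : ∀ i ≤ h, t i = sb ∨ t i = sx ∨ t i = sa)
      (one : ∀ i, h < i → i < e → t i = s1)
      (bl : ∀ i, e ≤ i → t i = sb) : Inv B h t
  | bLeftR (p h e : ℤ) (t : ℤ → Sym) (ph : p ≤ h) (he : h + 1 < e)
      (low : ∀ i < p, t i = sb ∨ t i = sx ∨ t i = sa)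
      (hp : t p = sr)
      (xx : ∀ i, p < i → i ≤ h → t i = sx)
      (one : ∀ i, h < i → i < e → t i = s1)
      (bl : ∀ i, e ≤ i → t i = sb) : Inv B h t
  | cRight (p q h m e : ℤ) (t : ℤ → Sym) (pq : p < q) (qh : q ≤ h) (hm : h ≤ m) (me : m ≤ e)
      (qm : q < h → h = m)
      (low : ∀ i < p, t i = sb ∨ t i = sx ∨ t i = sa)
      (hp : t p = sa)
      (xx : ∀ i, p < i → i < q → t i = sx)
      (rr : ∀ i, q ≤ i → i < h → t i = sr)
      (one : ∀ i, h ≤ i → i < m → t i = s1)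
      (zz : ∀ i, m ≤ i → i < e → t i = sz)
      (bl : ∀ i, e ≤ i → t i = sb) : Inv C h t
  | cLeft (p q h m e : ℤ) (t : ℤ → Sym) (pq : p < q) (ph : p ≤ h) (qh : q ≤ h + 1)
      (hm : h < m) (me : m < e)
      (qm : q ≤ h → m = h + 1)
      (low : ∀ i < p, t i = sb ∨ t i = sx ∨ t i = sa)
      (hp : t p = sa)
      (xx : ∀ i, p < i → i < q → t i = sx)
      (rr : ∀ i, q ≤ i → i ≤ h → t i = sr)
      (one : ∀ i, h < i → i < m → t i = s1)
      (zz : ∀ i, m ≤ i → i < e → t i = sz)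
      (bl : ∀ i, e ≤ i → t i = sb) : Inv C h t

theorem step_of {c : Cfg} {q' : St} {s w : Sym} {d : Bool} (hs : c.tape c.head = s)
    (hd : delta c.state s = some (w, d, q'))
    (hi : ∀ t' : ℤ → Sym, t' c.head = w → (∀ i, i ≠ c.head → t' i = c.tape i) →
      Inv q' (c.head + (if d then 1 else -1)) t') :
    ∃ c', step c = some c' ∧ Inv c'.state c'.head c'.tape := by
  refine ⟨⟨q', c.head + (if d then 1 else -1), Function.update c.tape c.head w⟩, ?_, ?_⟩
  · simp [step, hs, hd]
  · apply hi
    · simp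
    · intro i hne
      simp [hne]

theorem inv_step (c : Cfg) (hc : Inv c.state c.head c.tape) :
    ∃ c', step c = some c' ∧ Inv c'.state c'.head c'.tape := by
  obtain ⟨q, h, t⟩ := c
  dsimp only at hc
  cases hc with
  | aLeft h e t he low one bl =>
    rcases low h le_rfl with hs | hs | hs <;> refine step_of hs rfl ?_ <;>
      intro t' hw hn <;> dsimp only at hw hn ⊢
    · refine .aRight _ e e _ ?_ ?_ ?_ ?_ ?_ ?_ ?_ <;> grind
    · refine .aLeft _ e _ ?_ ?_ ?_ ?_ <;> grind
    · refine .aLeft _ e _ ?_ ?_ ?_ ?_ <;> grind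
  | aRight h m e t hm me he low one zz bl =>
    rcases hm.lt_or_eq with h1 | h1
    · refine step_of (one h le_rfl h1) rfl ?_
      intro t' hw hn; dsimp only at hw hn ⊢
      refine .bRight _ m e _ ?_ ?_ ?_ ?_ ?_ ?_ <;> grind
    · refine step_of (zz h h1.ge he) rfl ?_
      intro t' hw hn; dsimp only at hw hn ⊢
      refine .bRightR h _ e _ ?_ ?_ ?_ ?_ ?_ ?_ ?_ <;> grind
  | bRight h m e t hm me low one zz bl =>
    rcases hm.lt_or_eq with h1 | h1
    · refine step_of (one h le_rfl h1) rfl ?_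
      intro t' hw hn; dsimp only at hw hn ⊢
      refine .cRight h (h+1) _ m e _ ?_ ?_ ?_ ?_ ?_ ?_ ?_ ?_ ?_ ?_ ?_ ?_ <;> grind
    · rcases me.lt_or_eq with h2 | h2
      · refine step_of (zz h h1.ge (by lia)) rfl ?_
        intro t' hw hn; dsimp only at hw hn ⊢
        refine .bRight _ (h+1) e _ ?_ ?_ ?_ ?_ ?_ ?_ <;> grind
      · refine step_of (bl h (by lia)) rfl ?_
        intro t' hw hn; dsimp only at hw hn ⊢
        refine .bLeft _ (h+1) _ ?_ ?_ ?_ ?_ <;> grind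
  | bRightR p h e t ph he low hp xx zz bl =>
    rcases he.lt_or_eq with h1 | h1
    · refine step_of (zz h le_rfl h1) rfl ?_
      intro t' hw hn; dsimp only at hw hn ⊢
      refine .bRightR p _ e _ ?_ ?_ ?_ ?_ ?_ ?_ ?_ <;> grind
    · refine step_of (bl h h1.ge) rfl ?_
      intro t' hw hn; dsimp only at hw hn ⊢
      refine .bLeftR p _ (h+1) _ ?_ ?_ ?_ ?_ ?_ ?_ ?_ <;> grind
  | bLeft h e t he low one bl =>
    rcases low h le_rfl with hs | hs | hs <;> refine step_of hs rfl ?_ <;>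
      intro t' hw hn <;> dsimp only at hw hn ⊢
    · refine .bLeft _ e _ ?_ ?_ ?_ ?_ <;> grind
    · refine .bLeft _ e _ ?_ ?_ ?_ ?_ <;> grind
    · refine .aLeft _ e _ ?_ ?_ ?_ ?_ <;> grind
  | bLeftR p h e t ph he low hp xx one bl =>
    rcases ph.lt_or_eq with h1 | h1
    · refine step_of (xx h h1 le_rfl) rfl ?_
      intro t' hw hn; dsimp only at hw hn ⊢
      refine .bLeftR p _ e _ ?_ ?_ ?_ ?_ ?_ ?_ ?_ <;> grind
    · subst h1
      refine step_of hp rfl ?_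
      intro t' hw hn; dsimp only at hw hn ⊢
      refine .aRight _ e e _ ?_ ?_ ?_ ?_ ?_ ?_ ?_ <;> grind
  | cRight p q h m e t pq qh hm me qm low hp xx rr one zz bl =>
    rcases hm.lt_or_eq with h1 | h1
    · refine step_of (one h le_rfl h1) rfl ?_
      intro t' hw hn; dsimp only at hw hn ⊢
      refine .cRight p (h+1) _ m e _ ?_ ?_ ?_ ?_ ?_ ?_ ?_ ?_ ?_ ?_ ?_ ?_ <;> grind
    · rcases me.lt_or_eq with h2 | h2
      · refine step_of (zz h h1.ge (by lia)) rfl ?_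
        intro t' hw hn; dsimp only at hw hn ⊢
        refine .cRight p q _ (h+1) e _ ?_ ?_ ?_ ?_ ?_ ?_ ?_ ?_ ?_ ?_ ?_ ?_ <;> grind
      · refine step_of (bl h (by lia)) rfl ?_
        intro t' hw hn; dsimp only at hw hn ⊢
        refine .cLeft p q _ h (h+1) _ ?_ ?_ ?_ ?_ ?_ ?_ ?_ ?_ ?_ ?_ ?_ ?_ ?_ <;> grind
  | cLeft p q h m e t pq ph qh hm me qm low hp xx rr one zz bl =>
    rcases ph.lt_or_eq with h1 | h1
    · by_cases h2 : q ≤ h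
      · refine step_of (rr h h2 le_rfl) rfl ?_
        intro t' hw hn; dsimp only at hw hn ⊢
        refine .cLeft p q _ h e _ ?_ ?_ ?_ ?_ ?_ ?_ ?_ ?_ ?_ ?_ ?_ ?_ ?_ <;> grind
      · refine step_of (xx h h1 (by lia)) rfl ?_
        intro t' hw hn; dsimp only at hw hn ⊢
        refine .cLeft p h _ m e _ ?_ ?_ ?_ ?_ ?_ ?_ ?_ ?_ ?_ ?_ ?_ ?_ ?_ <;> grind
    · subst h1
      refine step_of hp rfl ?_
      intro t' hw hn; dsimp only at hw hn ⊢
      refine .aRight _ m e _ ?_ ?_ ?_ ?_ ?_ ?_ ?_ <;> grind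

theorem inv_steps (k : ℕ) : ∀ c : Cfg, Inv c.state c.head c.tape → steps k c ≠ none := by
  induction k with
  | zero => intro c _; simp [steps]
  | succ k ih =>
    intro c hc
    obtain ⟨c', h1, h2⟩ := inv_step c hc
    simpa [steps, h1] using ih c' h2

/-- For every positive integer `n`, Margenstern's machine `M4` never halts when
started from `ωb (A 1) 1^{n-1} bω`: it never reaches an undefined transition. -/
theorem M4_never_halts (n : ℕ) (hn : 0 < n) :
    ∀ t : ℕ, steps t (initCfg (List.replicate n s1)) ≠ none := by
  intro t
  apply inv_steps
  refine .aRight 0 n n _ ?_ le_rfl ?_ ?_ ?_ ?_ ?_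
  · lia
  · lia
  · intro i hi
    left
    simp [initCfg, tapeOf, not_le.mpr hi]
  · intro i h0 h1
    have : i.toNat < n := by lia
    simp [initCfg, tapeOf, h0, List.getD, this]
  · intro i h0 h1
    lia
  · intro i h0
    have : ¬ i.toNat < n := by lia
    simp [initCfg, tapeOf, List.getD, this]

end Collatz
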